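/- Let q be any prime power and F = GF(q). Let W = S_y and W' = S_{y'} be 5-dimensional F-subspaces of F^6 (squabs) neither of which has rank two, i.e. rank(M_y) ≠ 2 and rank(M_{y'}) ≠ 2. If W and W' contain the same number of nonsingular conics, then W and W' are projectively equivalent. -/

import Mathlib

open Matrix

namespace Conics

/-- Coefficient vector (a0,...,a5) of the product of two linear forms
`(b0*X0+b1*X1+b2*X2)*(c0*X0+c1*X1+c2*X2)`, where the quadratic form with
coefficient vector `a` is `a0*X0^2 + a1*X0*X1 + a2*X0*X2 + a3*X1^2 + a4*X1*X2 + a5*X2^2`. -/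
def mulLin {F : Type} [Field F] (b c : Fin 3 → F) : Fin 6 → F :=
  ![b 0 * c 0, b 0 * c 1 + b 1 * c 0, b 0 * c 2 + b 2 * c 0,
    b 1 * c 1, b 1 * c 2 + b 2 * c 1, b 2 * c 2]

/-- The discriminant of the quadratic form with coefficient vector `a`. -/
def disc {F : Type} [Field F] (a : Fin 6 → F) : F :=
  4 * a 0 * a 3 * a 5 + a 1 * a 2 * a 4 - a 0 * a 4 ^ 2 - a 3 * a 2 ^ 2 - a 5 * a 1 ^ 2

/-- `f_a` is a double line: `f_a = c * l^2` for a nonzero scalar `c` and nonzero linear form `l`. -/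
def IsDoubleLine {F : Type} [Field F] (a : Fin 6 → F) : Prop :=
  ∃ (c : F) (l : Fin 3 → F), c ≠ 0 ∧ l ≠ 0 ∧ a = c • mulLin l l

/-- `f_a` is a pair of (distinct) real lines: `f_a = l1 * l2` with neither linear form a scalar
multiple of the other. -/
def IsRealPair {F : Type} [Field F] (a : Fin 6 → F) : Prop :=
  ∃ l1 l2 : Fin 3 → F, (¬ ∃ t : F, l2 = t • l1) ∧ (¬ ∃ t : F, l1 = t • l2) ∧ a = mulLin l1 l2

/-- `f_a` is a pair of conjugate imaginary lines: singular, but not a product of two linear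
forms over `F`. -/
def IsImagPair {F : Type} [Field F] (a : Fin 6 → F) : Prop :=
  disc a = 0 ∧ ¬ ∃ l1 l2 : Fin 3 → F, a = mulLin l1 l2

/-- `f_a` is a nonsingular conic. -/
def IsNonsingular {F : Type} [Field F] (a : Fin 6 → F) : Prop :=
  disc a ≠ 0

/-- The number of conics of a given type `T` in a linear system `W` (a subspace of the space of
quadratic forms, identified with `F^6`): the number of 1-dimensional subspaces `⟨a⟩` of `W`,
`a ≠ 0`, such that `f_a` has type `T`. -/
noncomputable def numConics {F : Type} [Field F] (W : Submodule F (Fin 6 → F))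
    (T : (Fin 6 → F) → Prop) : ℕ :=
  Set.ncard {P : Submodule F (Fin 6 → F) |
    ∃ a : Fin 6 → F, a ≠ 0 ∧ a ∈ W ∧ T a ∧ P = Submodule.span F {a}}

/-- The symmetric 3×3 matrix associated with a point `y` of `PG(5,q)`. -/
def M {F : Type} [Field F] (y : Fin 6 → F) : Matrix (Fin 3) (Fin 3) F :=
  !![y 0, y 1, y 2; y 1, y 3, y 4; y 2, y 4, y 5]

/-- The pairing `B(a,y) = a0*y0 + ... + a5*y5`. -/
def Bform {F : Type} [Field F] (a y : Fin 6 → F) : F :=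
  a 0 * y 0 + a 1 * y 1 + a 2 * y 2 + a 3 * y 3 + a 4 * y 4 + a 5 * y 5

/-- The squab of conics associated with a (nonzero) point `y`: the hyperplane
`{a : B(a,y) = 0}` of the space of quadratic forms. -/
def squab {F : Type} [Field F] (y : Fin 6 → F) : Submodule F (Fin 6 → F) where
  carrier := {a | Bform a y = 0}
  add_mem' := by
    intro a b ha hb
    simp only [Set.mem_setOf_eq, Bform, Pi.add_apply] at *
    linear_combination ha + hb
  zero_mem' := by simp [Bform]
  smul_mem' := by
    intro c a ha
    simp only [Set.mem_setOf_eq, Bform, Pi.smul_apply, smul_eq_mul] at *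
    linear_combination c * ha

/-- The (upper triangular) matrix of the quadratic form `f_a`, so that `f_a(X) = Xᵀ U X`. -/
def upperMat {F : Type} [Field F] (a : Fin 6 → F) : Matrix (Fin 3) (Fin 3) F :=
  !![a 0, a 1, a 2; 0, a 3, a 4; 0, 0, a 5]

/-- The coefficient vector of the quadratic form `X ↦ Xᵀ N X`. -/
def coeffOf {F : Type} [Field F] (N : Matrix (Fin 3) (Fin 3) F) : Fin 6 → F :=
  ![N 0 0, N 0 1 + N 1 0, N 0 2 + N 2 0, N 1 1, N 1 2 + N 2 1, N 2 2]

/-- The coefficient vector of `f_a ∘ A`, i.e. of the quadratic form obtained from `f_a` by the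
invertible linear substitution of variables `X ↦ A·X`. -/
def subst {F : Type} [Field F] (A : Matrix (Fin 3) (Fin 3) F) (a : Fin 6 → F) : Fin 6 → F :=
  coeffOf (Aᵀ * upperMat a * A)

/-- Two linear systems of conics `W`, `W'` are projectively equivalent if there exists an
invertible matrix `A` with `W' = {coefficient vector of f_a ∘ A : a ∈ W}`. -/
def ProjEquiv {F : Type} [Field F] (W W' : Submodule F (Fin 6 → F)) : Prop :=
  ∃ A : Matrix (Fin 3) (Fin 3) F, IsUnit A ∧
    (W' : Set (Fin 6 → F)) = subst A '' (W : Set (Fin 6 → F))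

variable {F : Type} [Field F]

lemma disc_coeffOf (N : Matrix (Fin 3) (Fin 3) F) :
    disc (coeffOf N) = N.det + (N.adjugate * Nᵀ).trace := by
  simp only [Matrix.trace_fin_three, Matrix.mul_apply, Fin.sum_univ_three, Matrix.transpose_apply]
  simp [disc, coeffOf, Matrix.det_fin_three, Matrix.adjugate_fin_three]
  ring

lemma coeffOf_upperMat (a : Fin 6 → F) : coeffOf (upperMat a) = a := by
  funext i
  fin_cases i <;> simp [coeffOf, upperMat]

lemma coeffOf_congr (A N : Matrix (Fin 3) (Fin 3) F) :
    coeffOf (Aᵀ * upperMat (coeffOf N) * A) = coeffOf (Aᵀ * N * A) := by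
  funext i
  fin_cases i <;> simp [coeffOf, upperMat, Matrix.mul_apply, Fin.sum_univ_three] <;> ring

lemma subst_coeffOf (A N : Matrix (Fin 3) (Fin 3) F) :
    subst A (coeffOf N) = coeffOf (Aᵀ * N * A) := coeffOf_congr A N

lemma subst_subst (A B : Matrix (Fin 3) (Fin 3) F) (a : Fin 6 → F) :
    subst B (subst A a) = subst (A * B) a := by
  rw [subst, subst, coeffOf_congr, subst, Matrix.transpose_mul]
  simp only [Matrix.mul_assoc]

lemma subst_one (a : Fin 6 → F) : subst 1 a = a := by
  simp [subst, coeffOf_upperMat]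

lemma disc_subst (A : Matrix (Fin 3) (Fin 3) F) (a : Fin 6 → F) :
    disc (subst A a) = A.det ^ 2 * disc a := by
  conv_rhs => rw [← coeffOf_upperMat a]
  rw [subst, disc_coeffOf, disc_coeffOf]
  set U := upperMat a
  have h : (Aᵀ * U * A).adjugate * (Aᵀ * U * A)ᵀ
      = A.det • (A.adjugate * (U.adjugate * Uᵀ) * A) := by
    rw [Matrix.adjugate_mul_distrib, Matrix.adjugate_mul_distrib,
      Matrix.transpose_mul, Matrix.transpose_mul, Matrix.transpose_transpose]
    have : (Aᵀ).adjugate * Aᵀ = A.det • 1 := by rw [Matrix.adjugate_mul, Matrix.det_transpose]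
    calc A.adjugate * (U.adjugate * (Aᵀ).adjugate) * (Aᵀ * (Uᵀ * A))
        = A.adjugate * U.adjugate * ((Aᵀ).adjugate * Aᵀ) * (Uᵀ * A) := by
          simp only [Matrix.mul_assoc]
      _ = _ := by
          rw [this]; simp [Matrix.mul_assoc]
  rw [h, Matrix.trace_smul, Matrix.trace_mul_comm, ← Matrix.mul_assoc,
    Matrix.mul_adjugate, Matrix.det_mul, Matrix.det_mul, Matrix.det_transpose]
  simp
  ring

lemma Bform_subst (A : Matrix (Fin 3) (Fin 3) F) (a y y' : Fin 6 → F) (c : F)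
    (h : A * M y * Aᵀ = c • M y') : Bform (subst A a) y = c * Bform a y' := by
  have h00 := congrFun (congrFun h 0) 0
  have h01 := congrFun (congrFun h 0) 1
  have h02 := congrFun (congrFun h 0) 2
  have h11 := congrFun (congrFun h 1) 1
  have h12 := congrFun (congrFun h 1) 2
  have h22 := congrFun (congrFun h 2) 2
  simp [M, Matrix.mul_apply, Fin.sum_univ_three] at h00 h01 h02 h11 h12 h22
  simp [Bform, subst, coeffOf, upperMat, Matrix.mul_apply, Fin.sum_univ_three]
  linear_combination a 0 * h00 + a 1 * h01 + a 2 * h02 + a 3 * h11 + a 4 * h12 + a 5 * h22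

/-- Equivalence of points under congruence and scaling. -/
def Rel (y y' : Fin 6 → F) : Prop :=
  ∃ (A : Matrix (Fin 3) (Fin 3) F) (c : F), IsUnit A ∧ c ≠ 0 ∧ A * M y * Aᵀ = c • M y'

lemma Rel.symm {y y' : Fin 6 → F} (h : Rel y y') : Rel y' y := by
  obtain ⟨A, c, hA, hc, h⟩ := h
  have hd : IsUnit A.det := (Matrix.isUnit_iff_isUnit_det A).1 hA
  refine ⟨A⁻¹, c⁻¹, ?_, inv_ne_zero hc, ?_⟩
  · rw [Matrix.isUnit_nonsing_inv_iff]; exact hA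
  · have h' : M y' = c⁻¹ • (A * M y * Aᵀ) := by rw [h, smul_smul, inv_mul_cancel₀ hc, one_smul]
    have hdt : IsUnit (Aᵀ).det := by rwa [Matrix.det_transpose]
    rw [h', Matrix.transpose_nonsing_inv, Matrix.mul_smul, Matrix.smul_mul, Matrix.mul_assoc A,
      Matrix.nonsing_inv_mul_cancel_left _ _ hd, Matrix.mul_nonsing_inv_cancel_right _ _ hdt]

lemma Rel.trans {x y z : Fin 6 → F} (h : Rel x y) (h' : Rel y z) : Rel x z := by
  obtain ⟨A, c, hA, hc, h⟩ := h
  obtain ⟨B, d, hB, hd, h'⟩ := h'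
  refine ⟨B * A, c * d, hB.mul hA, mul_ne_zero hc hd, ?_⟩
  calc B * A * M x * (B * A)ᵀ = B * (A * M x * Aᵀ) * Bᵀ := by
        simp only [Matrix.transpose_mul, Matrix.mul_assoc]
    _ = _ := by rw [h, Matrix.mul_smul, Matrix.smul_mul, h', smul_smul]

lemma subst_inv_left {A : Matrix (Fin 3) (Fin 3) F} (hA : IsUnit A) (a : Fin 6 → F) :
    subst A (subst A⁻¹ a) = a := by
  rw [subst_subst, Matrix.nonsing_inv_mul _ ((Matrix.isUnit_iff_isUnit_det A).1 hA), subst_one]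

lemma subst_inv_right {A : Matrix (Fin 3) (Fin 3) F} (hA : IsUnit A) (a : Fin 6 → F) :
    subst A⁻¹ (subst A a) = a := by
  rw [subst_subst, Matrix.mul_nonsing_inv _ ((Matrix.isUnit_iff_isUnit_det A).1 hA), subst_one]

lemma mem_squab {a y : Fin 6 → F} : a ∈ squab y ↔ Bform a y = 0 := Iff.rfl

lemma Rel.projEquiv {y y' : Fin 6 → F} (h : Rel y y') : ProjEquiv (squab y) (squab y') := by
  obtain ⟨A, c, hA, hc, h⟩ := h.symm
  have key : ∀ a, subst A a ∈ squab y' ↔ a ∈ squab y := by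
    intro a
    rw [mem_squab, mem_squab, Bform_subst A a y' y c h]
    simp [hc]
  refine ⟨A, hA, ?_⟩
  ext b
  constructor
  · intro hb
    refine ⟨subst A⁻¹ b, ?_, subst_inv_left hA b⟩
    rw [SetLike.mem_coe, ← key, subst_inv_left hA]
    exact hb
  · rintro ⟨a, ha, rfl⟩
    exact (key a).2 ha

lemma rank_lemma (y : Fin 6 → F) (hrk : (M y).rank ≠ 2) (hd : (M y).det = 0)
    (r c : Fin 2 → Fin 3) : ((M y).submatrix r c).det = 0 := by
  by_contra hne
  have h1 : ((M y).submatrix r c).rank = 2 := by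
    rw [Matrix.rank_of_det_ne_zero hne]; simp
  have h2 : ((M y).submatrix r c).rank ≤ (M y).rank := Matrix.rank_submatrix_le _ _ _
  have h3 : (M y).rank ≤ 3 := Matrix.rank_le_width _
  have h4 : (M y).rank = 3 := by omega
  obtain ⟨v, hv, hv'⟩ := Matrix.exists_mulVec_eq_zero_iff.2 hd
  have h7 : LinearMap.ker (M y).mulVecLin = ⊥ := by
    have := LinearMap.finrank_range_add_finrank_ker (M y).mulVecLin
    change (M y).rank + _ = _ at this
    rw [h4] at this
    simp at this
    exact this
  apply hv
  have : v ∈ LinearMap.ker (M y).mulVecLin := by simpa using hv'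
  simpa [h7] using this
lemma rel_rank_one (y : Fin 6 → F) (hy : y ≠ 0) (hrk : (M y).rank ≠ 2) (hd : (M y).det = 0) :
    Rel ![1, 0, 0, 0, 0, 0] y := by
  have m1 := rank_lemma y hrk hd ![0, 1] ![0, 1]
  have m2 := rank_lemma y hrk hd ![0, 2] ![0, 2]
  have m3 := rank_lemma y hrk hd ![1, 2] ![1, 2]
  have m4 := rank_lemma y hrk hd ![0, 1] ![0, 2]
  have m5 := rank_lemma y hrk hd ![0, 2] ![1, 2]
  have m6 := rank_lemma y hrk hd ![0, 1] ![1, 2]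
  rw [Matrix.det_fin_two] at m1 m2 m3 m4 m5 m6
  simp [M] at m1 m2 m3 m4 m5 m6
  by_cases h0 : y 0 = 0
  · by_cases h3 : y 3 = 0
    · have h1 : y 1 = 0 := by simpa [h0] using m1
      have h2 : y 2 = 0 := by simpa [h0] using m2
      have h4 : y 4 = 0 := by simpa [h3] using m3
      have h5 : y 5 ≠ 0 := by
        intro h5
        apply hy
        funext i
        fin_cases i <;> assumption
      refine ⟨!![0, 1, 0; 0, 0, 1; 1, 0, 0], (y 5)⁻¹, ?_, inv_ne_zero h5, ?_⟩
      · rw [Matrix.isUnit_iff_isUnit_det, Matrix.det_fin_three]; simp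
      · ext i j
        fin_cases i <;> fin_cases j <;>
          simp [M, Matrix.mul_apply, Fin.sum_univ_three, h0, h1, h2, h3, h4, h5]
    · have h1 : y 1 = 0 := by simpa [h0] using m1
      have h2 : y 2 = 0 := by simpa [h0] using m2
      refine ⟨!![0, 1, 0; y 3, 0, 0; y 4, 0, 1], y 3, ?_, h3, ?_⟩
      · rw [Matrix.isUnit_iff_isUnit_det, Matrix.det_fin_three]; simp [h3]
      · ext i j
        fin_cases i <;> fin_cases j <;>
          simp [M, Matrix.mul_apply, Fin.sum_univ_three, h0, h1, h2] <;>
          first | ring1 | linear_combination m3 | linear_combination - m3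
  · refine ⟨!![y 0, 0, 0; y 1, 1, 0; y 2, 0, 1], y 0, ?_, h0, ?_⟩
    · rw [Matrix.isUnit_iff_isUnit_det, Matrix.det_fin_three]; simp [h0]
    · ext i j
      fin_cases i <;> fin_cases j <;>
        simp [M, Matrix.mul_apply, Fin.sum_univ_three] <;>
        first | ring1 | linear_combination - m1 | linear_combination - m2 | linear_combination - m4

/-- The bilinear form of `M y`. -/
def bil (y : Fin 6 → F) (v w : Fin 3 → F) : F :=
  v 0 * (y 0 * w 0 + y 1 * w 1 + y 2 * w 2) + v 1 * (y 1 * w 0 + y 3 * w 1 + y 4 * w 2) +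
    v 2 * (y 2 * w 0 + y 4 * w 1 + y 5 * w 2)

/-- The cross product of `M y v` and `M y w`. -/
def perp (y : Fin 6 → F) (v w : Fin 3 → F) : Fin 3 → F :=
  ![(y 1 * v 0 + y 3 * v 1 + y 4 * v 2) * (y 2 * w 0 + y 4 * w 1 + y 5 * w 2) -
      (y 2 * v 0 + y 4 * v 1 + y 5 * v 2) * (y 1 * w 0 + y 3 * w 1 + y 4 * w 2),
    (y 2 * v 0 + y 4 * v 1 + y 5 * v 2) * (y 0 * w 0 + y 1 * w 1 + y 2 * w 2) -
      (y 0 * v 0 + y 1 * v 1 + y 2 * v 2) * (y 2 * w 0 + y 4 * w 1 + y 5 * w 2),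
    (y 0 * v 0 + y 1 * v 1 + y 2 * v 2) * (y 1 * w 0 + y 3 * w 1 + y 4 * w 2) -
      (y 1 * v 0 + y 3 * v 1 + y 4 * v 2) * (y 0 * w 0 + y 1 * w 1 + y 2 * w 2)]

lemma bil_comm (y : Fin 6 → F) (v w : Fin 3 → F) : bil y v w = bil y w v := by
  simp only [bil]; ring

lemma bil_perp_left (y : Fin 6 → F) (v w : Fin 3 → F) : bil y v (perp y v w) = 0 := by
  simp [bil, perp]; ring

lemma bil_perp_right (y : Fin 6 → F) (v w : Fin 3 → F) : bil y w (perp y v w) = 0 := by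
  simp [bil, perp]; ring

lemma bil_perp_perp (y : Fin 6 → F) (v w : Fin 3 → F) :
    bil y (perp y v w) (perp y v w) =
      (M y).det * (bil y v v * bil y w w - bil y v w ^ 2) := by
  simp [bil, perp, M, Matrix.det_fin_three]; ring

lemma bil_add_right (y : Fin 6 → F) (v w w' : Fin 3 → F) :
    bil y v (w + w') = bil y v w + bil y v w' := by
  simp [bil]; ring

lemma bil_smul_right (y : Fin 6 → F) (v w : Fin 3 → F) (c : F) :
    bil y v (c • w) = c * bil y v w := by
  simp [bil]; ring

lemma bil_add_left (y : Fin 6 → F) (v w w' : Fin 3 → F) :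
    bil y (w + w') v = bil y w v + bil y w' v := by
  simp [bil]; ring

lemma bil_smul_left (y : Fin 6 → F) (v w : Fin 3 → F) (c : F) :
    bil y (c • w) v = c * bil y w v := by
  simp [bil]; ring

lemma gram_apply (y : Fin 6 → F) (A : Matrix (Fin 3) (Fin 3) F) (i j : Fin 3) :
    (A * M y * Aᵀ) i j = bil y (A i) (A j) := by
  simp only [Matrix.mul_apply, Fin.sum_univ_three, Matrix.transpose_apply]
  simp [M, bil]
  ring

lemma exists_isotropic [Fintype F] (y : Fin 6 → F) : ∃ v : Fin 3 → F, v ≠ 0 ∧ bil y v v = 0 := by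
  classical
  obtain ⟨p, hp⟩ := CharP.exists F
  have hpp : p.Prime := CharP.char_is_prime F p
  have : Fact p.Prime := ⟨hpp⟩
  let m : F → Fin 3 → Fin 3 → MvPolynomial (Fin 3) F := fun c i j =>
    MvPolynomial.C c * (MvPolynomial.X i * MvPolynomial.X j)
  have hm : ∀ c i j, (m c i j).totalDegree ≤ 2 := by
    intro c i j
    refine (MvPolynomial.totalDegree_mul _ _).trans ?_
    have := MvPolynomial.totalDegree_mul (MvPolynomial.X i : MvPolynomial (Fin 3) F)
      (MvPolynomial.X j)
    simp only [MvPolynomial.totalDegree_X, MvPolynomial.totalDegree_C] at this ⊢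
    omega
  have hadd : ∀ f g : MvPolynomial (Fin 3) F, f.totalDegree ≤ 2 → g.totalDegree ≤ 2 →
      (f + g).totalDegree ≤ 2 := fun f g hf hg =>
    (MvPolynomial.totalDegree_add f g).trans (max_le hf hg)
  let f := m (y 0) 0 0 + m (2 * y 1) 0 1 + m (2 * y 2) 0 2 + m (y 3) 1 1 + m (2 * y 4) 1 2 +
    m (y 5) 2 2
  have hf : f.totalDegree < Fintype.card (Fin 3) := by
    have : f.totalDegree ≤ 2 := by
      refine hadd _ _ (hadd _ _ (hadd _ _ (hadd _ _ (hadd _ _ ?_ ?_) ?_) ?_) ?_) ?_ <;> apply hm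
    simpa using Nat.lt_succ_of_le this
  have heval : ∀ v, MvPolynomial.eval v f = bil y v v := by
    intro v
    simp [f, m, bil]; ring
  have hdvd := char_dvd_card_solutions p hf
  have h0 : MvPolynomial.eval (0 : Fin 3 → F) f = 0 := by rw [heval]; simp [bil]
  have hpos : 0 < Fintype.card { x : Fin 3 → F // MvPolynomial.eval x f = 0 } :=
    Fintype.card_pos_iff.2 ⟨⟨0, h0⟩⟩
  have h2 : 1 < Fintype.card { x : Fin 3 → F // MvPolynomial.eval x f = 0 } :=
    lt_of_lt_of_le hpp.one_lt (Nat.le_of_dvd hpos hdvd)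
  obtain ⟨⟨v, hv⟩, hne⟩ := Fintype.exists_ne_of_one_lt_card h2 ⟨0, h0⟩
  refine ⟨v, fun h => hne (Subtype.ext h), ?_⟩
  rw [← heval]; exact hv

lemma solve_quad [Fintype F] (α β : F) (hβ : β ≠ 0) : ∃ s r : F, α + 2 * s + r ^ 2 * β = 0 := by
  by_cases h2 : (2 : F) = 0
  · have hc : ringChar F = 2 := by
      by_contra h
      exact Ring.two_ne_zero h h2
    obtain ⟨r, hr⟩ := FiniteField.isSquare_of_char_two hc (-α / β)
    refine ⟨0, r, ?_⟩
    rw [pow_two, ← hr]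
    field_simp
    ring
  · refine ⟨-α / 2, 0, ?_⟩
    field_simp
    ring

lemma exists_hyperbolic [Fintype F] (y : Fin 6 → F) (hd : (M y).det ≠ 0) :
    ∃ v w : Fin 3 → F, bil y v v = 0 ∧ bil y w w = 0 ∧ bil y v w = 1 := by
  obtain ⟨v, hv, hvv⟩ := exists_isotropic y
  have hMv : (M y).mulVec v ≠ 0 := fun h =>
    hd (Matrix.exists_mulVec_eq_zero_iff.1 ⟨v, hv, h⟩)
  obtain ⟨i, hi⟩ := Function.ne_iff.1 hMv
  have hb : ∀ c, bil y v (Pi.single i c) = (M y).mulVec v i * c := by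
    intro c
    fin_cases i <;> simp [bil, M, Matrix.mulVec, dotProduct, Fin.sum_univ_three] <;> ring
  have hw : bil y v (Pi.single i ((M y).mulVec v i)⁻¹) = 1 := by
    rw [hb]; exact mul_inv_cancel₀ hi
  generalize (Pi.single i ((M y).mulVec v i)⁻¹ : Fin 3 → F) = w at hw
  have hu := bil_perp_perp y v w
  have hvu := bil_perp_left y v w
  have hwu := bil_perp_right y v w
  generalize perp y v w = u at hu hvu hwu
  rw [hvv, hw] at hu
  have hu0 : bil y u u ≠ 0 := by rw [hu]; simpa using hd
  obtain ⟨s, r, hsr⟩ := solve_quad (bil y w w) (bil y u u) hu0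
  refine ⟨v, w + s • v + r • u, hvv, ?_, ?_⟩
  · simp only [bil_add_right, bil_add_left, bil_smul_left, bil_smul_right, bil_comm y u v,
      bil_comm y u w, bil_comm y w v, hvv, hw, hvu, hwu]
    linear_combination hsr
  · simp only [bil_add_right, bil_smul_right, hvv, hw, hvu]
    ring

lemma rel_rank_three [Fintype F] (y : Fin 6 → F) (hd : (M y).det ≠ 0) :
    Rel y ![0, 0, 1, -1, 0, 0] := by
  obtain ⟨v, w, hv, hw, hvw⟩ := exists_hyperbolic y hd
  have hu := bil_perp_perp y v w
  have hvu := bil_perp_left y v w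
  have hwu := bil_perp_right y v w
  generalize perp y v w = u at hu hvu hwu
  rw [hv, hw, hvw] at hu
  have hA' : ∀ d : F, bil y u u = -d →
      (Matrix.of ![d • v, u, w]) * M y * (Matrix.of ![d • v, u, w])ᵀ
      = d • M ![0, 0, 1, -1, 0, 0] := by
    intro d hu
    have r0 : Matrix.of ![d • v, u, w] 0 = d • v := rfl
    have r1 : Matrix.of ![d • v, u, w] 1 = u := rfl
    have r2 : Matrix.of ![d • v, u, w] 2 = w := rfl
    have e1 := bil_comm y u v
    have e2 := bil_comm y u w
    have e3 := bil_comm y w v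
    ext i j
    rw [gram_apply]
    generalize Matrix.of ![d • v, u, w] = A at r0 r1 r2
    fin_cases i <;> fin_cases j <;>
      simp [r0, r1, r2, bil_smul_left, bil_smul_right, e1, e2, e3, hv, hw, hvw, hvu, hwu, hu] <;>
      simp [M]
  have hA := hA' _ (by rw [hu]; ring)
  refine ⟨_, _, ?_, hd, hA⟩
  rw [Matrix.isUnit_iff_isUnit_det, isUnit_iff_ne_zero]
  intro h0
  have := congrArg Matrix.det hA
  rw [Matrix.det_mul, Matrix.det_mul, h0, Matrix.det_smul] at this
  have h1 : (M (![0, 0, 1, -1, 0, 0] : Fin 6 → F)).det = 1 := by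
    simp [M, Matrix.det_fin_three]
  rw [h1] at this
  simp at this
  exact hd (pow_eq_zero_iff (by norm_num) |>.1 this.symm)
lemma disc_smul (c : F) (a : Fin 6 → F) : disc (c • a) = c ^ 3 * disc a := by
  simp [disc]; ring

lemma disc_ne_zero_ne {a : Fin 6 → F} (h : disc a ≠ 0) : a ≠ 0 := by
  rintro rfl
  simp [disc] at h

/-- The affine number of nonsingular forms in a squab. -/
noncomputable def nsCount (y : Fin 6 → F) : ℕ := Set.ncard {a | a ∈ squab y ∧ disc a ≠ 0}

/-- The affine number of singular forms in a squab. -/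
noncomputable def sgCount (y : Fin 6 → F) : ℕ := Set.ncard {a | a ∈ squab y ∧ disc a = 0}

lemma nsCount_eq [Fintype F] (y : Fin 6 → F) :
    nsCount y = numConics (squab y) IsNonsingular * (Fintype.card F - 1) := by
  classical
  let S : Finset (Fin 6 → F) := Finset.univ.filter fun a => a ∈ squab y ∧ disc a ≠ 0
  let φ : (Fin 6 → F) → Submodule F (Fin 6 → F) := fun a => Submodule.span F {a}
  have h1 : nsCount y = S.card := by
    rw [nsCount, ← Set.ncard_coe_finset]
    congr 1
    ext a; simp [S]
  have h2 : numConics (squab y) IsNonsingular = (S.image φ).card := by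
    rw [numConics, ← Set.ncard_coe_finset]
    congr 1
    ext P
    simp only [Finset.coe_image, Set.mem_image, Finset.mem_coe, S, Finset.mem_filter,
      Finset.mem_univ, true_and, IsNonsingular, φ]
    constructor
    · rintro ⟨a, -, h, h', rfl⟩
      exact ⟨a, ⟨h, h'⟩, rfl⟩
    · rintro ⟨a, ⟨h, h'⟩, rfl⟩
      exact ⟨a, disc_ne_zero_ne h', h, h', rfl⟩
  rw [h1, h2, Finset.card_eq_sum_card_image φ S, Finset.sum_const_nat]
  intro P hP
  obtain ⟨a, ha, rfl⟩ := Finset.mem_image.1 hP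
  simp only [S, Finset.mem_filter, Finset.mem_univ, true_and] at ha
  have ha0 := disc_ne_zero_ne ha.2
  rw [← Fintype.card_units, ← Finset.card_univ]
  symm
  apply Finset.card_bij (fun (c : Fˣ) _ => (c : F) • a)
  · intro c _
    simp only [S, Finset.mem_filter, Finset.mem_univ, true_and]
    refine ⟨⟨(squab y).smul_mem _ ha.1, ?_⟩, ?_⟩
    · rw [disc_smul]
      exact mul_ne_zero (pow_ne_zero _ c.ne_zero) ha.2
    · exact Submodule.span_singleton_eq_span_singleton.2 ⟨c⁻¹, by
        rw [Units.smul_def, smul_smul]; simp⟩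
  · intro c _ d _ h
    exact Units.ext (smul_left_injective F ha0 h)
  · intro b hb
    simp only [S, Finset.mem_filter, Finset.mem_univ, true_and] at hb
    obtain ⟨z, hz⟩ := Submodule.span_singleton_eq_span_singleton.1 hb.2.symm
    exact ⟨z, Finset.mem_univ _, hz⟩

lemma Rel.nsCount_eq {y y' : Fin 6 → F} (h : Rel y y') : nsCount y' = nsCount y := by
  obtain ⟨A, c, hA, hc, h⟩ := h
  have hd : A.det ≠ 0 := ((Matrix.isUnit_iff_isUnit_det A).1 hA).ne_zero
  have hB : ∀ a, subst A a ∈ squab y ↔ a ∈ squab y' := by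
    intro a
    rw [mem_squab, mem_squab, Bform_subst A a y y' c h]
    simp [hc]
  have hD : ∀ a, disc (subst A a) ≠ 0 ↔ disc a ≠ 0 := by
    intro a
    rw [disc_subst]
    simp [hd]
  apply Set.ncard_congr (fun a _ => subst A a)
  · intro a ha
    exact ⟨(hB a).2 ha.1, (hD a).2 ha.2⟩
  · intro a b _ _ hab
    rw [← subst_inv_right hA a, ← subst_inv_right hA b]
    exact congrArg _ hab
  · intro b hb
    refine ⟨subst A⁻¹ b, ?_, subst_inv_left hA b⟩
    rw [← subst_inv_left hA b] at hb
    exact ⟨(hB _).1 hb.1, (hD _).1 hb.2⟩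

lemma count_add [Fintype F] (y : Fin 6 → F) :
    sgCount y + nsCount y = Set.ncard (squab y : Set (Fin 6 → F)) := by
  rw [sgCount, nsCount, ← Set.ncard_union_eq]
  · congr 1
    ext a
    simp only [Set.mem_union, Set.mem_setOf_eq, SetLike.mem_coe]
    tauto
  · rw [Set.disjoint_left]
    rintro a ⟨_, h⟩ ⟨_, h'⟩
    exact h' h

lemma squab_card_le [Fintype F] : Set.ncard (squab (![1, 0, 0, 0, 0, 0] : Fin 6 → F) : Set (Fin 6 → F))
    ≤ Set.ncard (squab (![0, 0, 1, -1, 0, 0] : Fin 6 → F) : Set (Fin 6 → F)) := by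
  apply Set.ncard_le_ncard_of_injOn (fun a => ![a 1, a 2, a 3, a 3, a 4, a 5])
  · intro a _
    simp [squab, Bform]
  · intro a ha b hb hab
    simp [squab, Bform] at ha hb
    have h0 := congrFun hab 0
    have h1 := congrFun hab 1
    have h2 := congrFun hab 2
    have h4 := congrFun hab 4
    have h5 := congrFun hab 5
    simp at h0 h1 h2 h4 h5
    funext i
    fin_cases i <;> simp [*]

lemma sgCount_three_le [Fintype F] :
    sgCount (![0, 0, 1, -1, 0, 0] : Fin 6 → F) ≤ Fintype.card (F × F × F × F) := by
  classical
  rw [← Nat.card_eq_fintype_card, ← Set.ncard_univ]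
  obtain ⟨g, hg1, hg2, hg3⟩ : ∃ g : (Fin 6 → F) → F × F × F × F,
      (∀ a, 4 * a 5 * a 3 - a 4 ^ 2 ≠ 0 → g a = (a 1, a 3, a 4, a 5)) ∧
      (∀ a, 4 * a 5 * a 3 - a 4 ^ 2 = 0 → a 5 ≠ 0 → g a = (a 0, a 3, a 4, a 5)) ∧
      (∀ a, 4 * a 5 * a 3 - a 4 ^ 2 = 0 → a 5 = 0 → g a = (a 0, a 1, 0, 0)) :=
    ⟨fun a => if 4 * a 5 * a 3 - a 4 ^ 2 ≠ 0 then (a 1, a 3, a 4, a 5)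
      else if a 5 ≠ 0 then (a 0, a 3, a 4, a 5) else (a 0, a 1, 0, 0),
      fun a h => by beta_reduce; rw [if_pos h],
      fun a h h5 => by beta_reduce; rw [if_neg (by simpa using h), if_pos h5],
      fun a h h5 => by beta_reduce; rw [if_neg (by simpa using h), if_neg (by simpa using h5)]⟩
  apply Set.ncard_le_ncard_of_injOn g
  · intro a _
    exact Set.mem_univ _
  · rintro a ⟨ha, ha'⟩ b ⟨hb, hb'⟩ hab
    simp [mem_squab, Bform] at ha hb
    have ha2 : a 2 = a 3 := by linear_combination ha
    have hb2 : b 2 = b 3 := by linear_combination hb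
    simp only [disc, ha2, hb2] at ha' hb'
    have key : a 0 = b 0 ∧ a 1 = b 1 ∧ a 3 = b 3 ∧ a 4 = b 4 ∧ a 5 = b 5 := by
      -- points on the cone with vanishing last coordinate
      have aux : ∀ c : Fin 6 → F, 4 * c 0 * c 3 * c 5 + c 1 * c 3 * c 4 - c 0 * c 4 ^ 2
          - c 3 * c 3 ^ 2 - c 5 * c 1 ^ 2 = 0 → 4 * c 5 * c 3 - c 4 ^ 2 = 0 → c 5 = 0 →
          c 3 = 0 ∧ c 4 = 0 := by
        intro c hc h h5
        have h4 : c 4 = 0 := by simpa [h5] using h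
        refine ⟨?_, h4⟩
        simpa [h5, h4, ← pow_succ'] using hc
      by_cases hDa : 4 * a 5 * a 3 - a 4 ^ 2 = 0 <;> by_cases hDb : 4 * b 5 * b 3 - b 4 ^ 2 = 0
      · by_cases h5a : a 5 = 0 <;> by_cases h5b : b 5 = 0
        · rw [hg3 a hDa h5a, hg3 b hDb h5b] at hab; simp only [Prod.mk.injEq] at hab
          obtain ⟨h3, h4⟩ := aux a ha' hDa h5a
          obtain ⟨h3', h4'⟩ := aux b hb' hDb h5b
          simp [*]
        · rw [hg3 a hDa h5a, hg2 b hDb h5b] at hab; simp only [Prod.mk.injEq] at hab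
          exact absurd hab.2.2.2.symm h5b
        · rw [hg2 a hDa h5a, hg3 b hDb h5b] at hab; simp only [Prod.mk.injEq] at hab
          exact absurd hab.2.2.2 h5a
        · rw [hg2 a hDa h5a, hg2 b hDb h5b] at hab; simp only [Prod.mk.injEq] at hab
          obtain ⟨h0, h3, h4, h5⟩ := hab
          refine ⟨h0, ?_, h3, h4, h5⟩
          rw [h0, h3, h4, h5] at ha'
          by_contra hne
          have hne' : a 1 - b 1 ≠ 0 := sub_ne_zero.2 hne
          have hs : b 5 * (a 1 + b 1) - b 4 * b 3 = 0 := by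
            have : (a 1 - b 1) * (b 5 * (a 1 + b 1) - b 4 * b 3) = 0 := by
              linear_combination hb' - ha'
            exact (mul_eq_zero.1 this).resolve_left hne'
          have : (b 5 * (a 1 - b 1)) ^ 2 = 0 := by
            linear_combination hs * (b 5 * (a 1 + b 1) + b 4 * b 3) - 4 * b 5 * b 1 * hs
              - 4 * b 5 * (hb' - b 0 * hDb) - b 3 ^ 2 * hDb
          exact mul_ne_zero h5b hne' (pow_eq_zero_iff (two_ne_zero) |>.1 this)
      · exfalso
        by_cases h5a : a 5 = 0
        · rw [hg3 a hDa h5a, hg1 b hDb] at hab; simp only [Prod.mk.injEq] at hab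
          obtain ⟨-, -, h4, h5⟩ := hab
          apply hDb
          rw [← h4, ← h5]; ring
        · rw [hg2 a hDa h5a, hg1 b hDb] at hab; simp only [Prod.mk.injEq] at hab
          obtain ⟨-, h3, h4, h5⟩ := hab
          apply hDb
          rw [← h3, ← h4, ← h5]; exact hDa
      · exfalso
        by_cases h5b : b 5 = 0
        · rw [hg1 a hDa, hg3 b hDb h5b] at hab; simp only [Prod.mk.injEq] at hab
          obtain ⟨-, -, h4, h5⟩ := hab
          apply hDa
          rw [h4, h5]; ring
        · rw [hg1 a hDa, hg2 b hDb h5b] at hab; simp only [Prod.mk.injEq] at hab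
          obtain ⟨-, h3, h4, h5⟩ := hab
          apply hDa
          rw [h3, h4, h5]; exact hDb
      · rw [hg1 a hDa, hg1 b hDb] at hab; simp only [Prod.mk.injEq] at hab
        obtain ⟨h1, h3, h4, h5⟩ := hab
        refine ⟨?_, h1, h3, h4, h5⟩
        rw [h1, h3, h4, h5] at ha'
        have : (a 0 - b 0) * (4 * b 5 * b 3 - b 4 ^ 2) = 0 := by
          linear_combination ha' - hb'
        exact sub_eq_zero.1 ((mul_eq_zero.1 this).resolve_right hDb)
    obtain ⟨h0, h1, h3, h4, h5⟩ := key
    funext i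
    fin_cases i <;> simp [*]

lemma lt_sgCount_one [Fintype F] :
    Fintype.card (F × F × F × F) < sgCount (![1, 0, 0, 0, 0, 0] : Fin 6 → F) := by
  classical
  let h : F × F × F × F → (Fin 6 → F) := fun p =>
    if p.1 ≠ 0 then
      ![0, p.1, p.2.1, p.2.2.1, p.2.2.2, (p.1 * p.2.1 * p.2.2.2 - p.2.2.1 * p.2.1 ^ 2) / p.1 ^ 2]
    else if p.2.1 ≠ 0 then ![0, 0, p.2.1, 0, p.2.2.2, p.2.2.1]
    else ![0, 0, 0, p.2.2.1, p.2.2.2, 0]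
  have hinj : Function.Injective h := by
    rintro ⟨x, y, z, w⟩ ⟨x', y', z', w'⟩ hh
    have h1 := congrFun hh 1
    have h2 := congrFun hh 2
    have h3 := congrFun hh 3
    have h4 := congrFun hh 4
    have h5 := congrFun hh 5
    clear hh
    by_cases hx : x = 0 <;> by_cases hx' : x' = 0 <;> by_cases hy : y = 0 <;>
      by_cases hy' : y' = 0 <;> simp [h, hx, hx', hy, hy'] at h1 h2 h3 h4 h5 ⊢ <;> grind
  rw [← Nat.card_eq_fintype_card, ← Set.ncard_univ, ← Set.ncard_image_of_injective _ hinj]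
  apply Set.ncard_lt_ncard
  · rw [Set.ssubset_iff_of_subset]
    · refine ⟨![0, 0, 0, 0, 0, 1], ⟨by simp [mem_squab, Bform], by simp [disc]⟩, ?_⟩
      rintro ⟨⟨x, y, z, w⟩, -, hh⟩
      have h1 := congrFun hh 1
      have h2 := congrFun hh 2
      have h5 := congrFun hh 5
      by_cases hx : x = 0 <;> by_cases hy : y = 0 <;> simp [h, hx, hy] at h1 h2 h5
    · rintro _ ⟨⟨x, y, z, w⟩, -, rfl⟩
      refine ⟨?_, ?_⟩
      · rw [mem_squab]
        by_cases hx : x = 0 <;> by_cases hy : y = 0 <;> simp [h, hx, hy, Bform]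
      · by_cases hx : x = 0 <;> by_cases hy : y = 0 <;> simp [h, hx, hy, disc]
  · exact Set.toFinite _

lemma not_rel_count [Fintype F] :
    nsCount (![1, 0, 0, 0, 0, 0] : Fin 6 → F) ≠ nsCount (![0, 0, 1, -1, 0, 0] : Fin 6 → F) := by
  intro h
  have h1 := count_add (![1, 0, 0, 0, 0, 0] : Fin 6 → F)
  have h2 := count_add (![0, 0, 1, -1, 0, 0] : Fin 6 → F)
  have h3 := squab_card_le (F := F)
  have h4 := sgCount_three_le (F := F)
  have h5 := lt_sgCount_one (F := F)
  omega

/-- the number of nonsingular conics is a complete invariant for squabs not of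
rank two. -/
theorem squabs_not_rank_two_equiv_of_same_nonsingular (F : Type) [Field F] [Fintype F]
    (y y' : Fin 6 → F) (hy : y ≠ 0) (hy' : y' ≠ 0)
    (hrk : (M y).rank ≠ 2) (hrk' : (M y').rank ≠ 2)
    (hn : numConics (squab y) IsNonsingular = numConics (squab y') IsNonsingular) :
    ProjEquiv (squab y) (squab y') := by
  have hc : nsCount y = nsCount y' := by rw [nsCount_eq, nsCount_eq, hn]
  apply Rel.projEquiv
  by_cases hd : (M y).det = 0 <;> by_cases hd' : (M y').det = 0
  · exact (rel_rank_one y hy hrk hd).symm.trans (rel_rank_one y' hy' hrk' hd')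
  · exfalso
    apply not_rel_count (F := F)
    rw [← (rel_rank_one y hy hrk hd).nsCount_eq, (rel_rank_three y' hd').nsCount_eq, hc]
  · exfalso
    apply not_rel_count (F := F)
    rw [← (rel_rank_one y' hy' hrk' hd').nsCount_eq, (rel_rank_three y hd).nsCount_eq, hc]
  · exact (rel_rank_three y hd).trans (rel_rank_three y' hd').symm
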